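/- arXiv:1908.08315 — 3 statements merged into one kernel-verified Lean document; each statement's English description precedes it below -/
import Mathlib

section
/- The following are equivalent for a subshift X: (i) for every finite set Λ of words, each empty or in L_X, with at least one element of Λ in L_X, the set F_Λ is either empty or infinite; (ii) every nonempty constructible set is infinite; (iii) the family {E_a : a ∈ Σ} is a cover for E(X), i.e., every nonempty constructible set has nonempty intersection with E_a for some a ∈ Σ; (iv) there is no ground ultra-character, i.e., every ultra-character φ on E(X) satisfies φ(E_t) = 1 for some t ∈ L_X; (v) for every ultra-character φ on E(X) there exists ω ∈ X such that φ = φ_ω (as functions on the constructible sets). -/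
open Set

variable {α : Type*}

/-- The left shift map on infinite words. -/
def lshift (x : ℕ → α) : ℕ → α := fun n => x (n + 1)

/-- The finite word `w` occurs as a consecutive block of the infinite word `x`. -/
def OccursIn (w : List α) (x : ℕ → α) : Prop :=
  ∃ k : ℕ, ∀ i : Fin w.length, w.get i = x (k + (i : ℕ))

/-- The language of `X`: all nonempty finite words occurring as a consecutive block
of some member of `X`. -/
def language (X : Set (ℕ → α)) : Set (List α) :=
  {w | w ≠ [] ∧ ∃ x ∈ X, OccursIn w x}

/-- `F_Λ = {s ∈ L_X : ts ∈ L_X for every t ∈ Λ}`. -/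
def FLam (X : Set (ℕ → α)) (Λ : Finset (List α)) : Set (List α) :=
  {s | s ∈ language X ∧ ∀ t ∈ Λ, t ++ s ∈ language X}

/-- The constructible subsets of the language: `∅` and the sets `uF_Λ` with `Λ` a finite
set of words, each empty or in `L_X`, at least one in `L_X`, and `u ∈ Λ`. -/
def Constructible (X : Set (ℕ → α)) (A : Set (List α)) : Prop :=
  A = ∅ ∨ ∃ (Λ : Finset (List α)) (u : List α),
    (∀ t ∈ Λ, t = [] ∨ t ∈ language X) ∧ (∃ t ∈ Λ, t ∈ language X) ∧ u ∈ Λ ∧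
    A = (fun s => u ++ s) '' FLam X Λ

/-- `σ_ω`: the set of nonempty finite prefixes of the infinite word `ω`. -/
def infPrefixes (ω : ℕ → α) : Set (List α) :=
  {w | w ≠ [] ∧ ∀ i : Fin w.length, w.get i = ω (i : ℕ)}

/-- Concatenation of a finite word with an infinite word. -/
def wcat (w : List α) (x : ℕ → α) : ℕ → α :=
  fun n => if h : n < w.length then w.get ⟨n, h⟩ else x (n - w.length)

/-- A character on the semilattice `E(X)` of constructible sets: a `{0,1}`-valued map
vanishing at `∅`, multiplicative on constructible sets, and not identically zero. -/
def IsCharacter (X : Set (ℕ → α)) (φ : Set (List α) → Bool) : Prop :=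
  φ ∅ = false ∧
  (∀ A B : Set (List α), Constructible X A → Constructible X B →
    φ (A ∩ B) = (φ A && φ B)) ∧
  (∃ A : Set (List α), Constructible X A ∧ φ A = true)

/-- An essentially tight character: `φ(A) = max φ(Bᵢ)` whenever `A, B₁, …, B_n` are
constructible and the symmetric difference `A Δ (B₁ ∪ … ∪ B_n)` is finite. -/
def IsEssTightChar (X : Set (ℕ → α)) (φ : Set (List α) → Bool) : Prop :=
  ∀ (A : Set (List α)) (n : ℕ) (B : Fin n → Set (List α)),
    Constructible X A → (∀ i, Constructible X (B i)) →
    (symmDiff A (⋃ i, B i)).Finite →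
    (φ A = true ↔ ∃ i, φ (B i) = true)

/-- A filter on `E(X)`: a family of nonempty constructible sets closed under
intersection and upward closed among constructible sets. -/
def IsCFilter (X : Set (ℕ → α)) (ξ : Set (Set (List α))) : Prop :=
  (∀ A ∈ ξ, Constructible X A ∧ A ≠ ∅) ∧
  (∀ A ∈ ξ, ∀ B ∈ ξ, A ∩ B ∈ ξ) ∧
  (∀ A ∈ ξ, ∀ B : Set (List α), Constructible X B → A ⊆ B → B ∈ ξ)

/-- An ultrafilter on `E(X)`: a filter maximal among filters. -/
def IsCUltrafilter (X : Set (ℕ → α)) (ξ : Set (Set (List α))) : Prop :=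
  IsCFilter X ξ ∧ ∀ ξ' : Set (Set (List α)), IsCFilter X ξ' → ξ ⊆ ξ' → ξ' = ξ

/-- An ultra-character: a character whose family of `1`-valued constructible sets is an
ultrafilter on `E(X)`. -/
def IsUltraChar (X : Set (ℕ → α)) (φ : Set (List α) → Bool) : Prop :=
  IsCharacter X φ ∧ IsCUltrafilter X {A | Constructible X A ∧ φ A = true}

/-- `E_u = {us : s ∈ F_u}`. -/
def Eset (X : Set (ℕ → α)) (u : List α) : Set (List α) :=
  (fun s => u ++ s) '' {s | s ∈ language X ∧ u ++ s ∈ language X}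

theorem lang_pre {X : Set (ℕ → α)} {u v : List α} (h : u ++ v ∈ language X) (hu : u ≠ []) :
    u ∈ language X := by
  obtain ⟨-, x, hx, k, hk⟩ := h
  refine ⟨hu, x, hx, k, fun i => ?_⟩
  have := hk ⟨i, by simp; omega⟩
  simpa [List.getElem_append_left] using this

theorem lang_suf {X : Set (ℕ → α)} {u v : List α} (h : u ++ v ∈ language X) (hv : v ≠ []) :
    v ∈ language X := by
  obtain ⟨-, x, hx, k, hk⟩ := h
  refine ⟨hv, x, hx, k + u.length, fun i => ?_⟩
  have := hk ⟨u.length + i, by simp⟩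
  simpa [add_assoc] using this

theorem mem_Eset {X : Set (ℕ → α)} {t w : List α} :
    w ∈ Eset X t ↔ w ∈ language X ∧ ∃ s, s ≠ [] ∧ w = t ++ s := by
  constructor
  · rintro ⟨s, ⟨h1, h2⟩, rfl⟩
    exact ⟨h2, s, h1.1, rfl⟩
  · rintro ⟨h, s, hs, rfl⟩
    exact ⟨s, ⟨lang_suf h hs, h⟩, rfl⟩

theorem constr_Eset {X : Set (ℕ → α)} {t : List α} (ht : t ∈ language X) :
    Constructible X (Eset X t) := by
  right
  refine ⟨{t}, t, by simp [ht], by simp [ht], by simp, ?_⟩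
  simp [Eset, FLam]

/-- membership in a constructible set -/
theorem mem_uF {X : Set (ℕ → α)} {Λ : Finset (List α)} {u w : List α} :
    w ∈ (fun s => u ++ s) '' FLam X Λ ↔
      ∃ s, s ≠ [] ∧ w = u ++ s ∧ s ∈ language X ∧ ∀ t ∈ Λ, t ++ s ∈ language X := by
  constructor
  · rintro ⟨s, hs, rfl⟩
    exact ⟨s, hs.1.1, rfl, hs.1, hs.2⟩
  · rintro ⟨s, -, rfl, h1, h2⟩
    exact ⟨s, ⟨h1, h2⟩, rfl⟩

theorem constr_sub {X : Set (ℕ → α)} {A : Set (List α)} (hA : Constructible X A) :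
    A ⊆ language X := by
  rcases hA with rfl | ⟨Λ, u, h1, h2, h3, rfl⟩
  · simp
  · intro w hw
    obtain ⟨s, hs, rfl, h4, h5⟩ := mem_uF.1 hw
    exact h5 u h3

theorem constr_inter_aux [DecidableEq α] {X : Set (ℕ → α)} {Λ Γ : Finset (List α)} {u w : List α}
    (h1 : ∀ t ∈ Λ, t = [] ∨ t ∈ language X) (h2 : ∃ t ∈ Λ, t ∈ language X) (h3 : u ∈ Λ)
    (g1 : ∀ t ∈ Γ, t = [] ∨ t ∈ language X) (g2 : ∃ t ∈ Γ, t ∈ language X) (g3 : u ++ w ∈ Γ) :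
    Constructible X (((fun s => u ++ s) '' FLam X Λ) ∩ ((fun s => (u ++ w) ++ s) '' FLam X Γ)) := by
  by_cases hne : (((fun s => u ++ s) '' FLam X Λ) ∩ ((fun s => (u ++ w) ++ s) '' FLam X Γ)) = ∅
  · left; exact hne
  right
  obtain ⟨z, ⟨s, hs, rfl⟩, ⟨r, hr, hz⟩⟩ := Set.nonempty_iff_ne_empty.2 hne
  have hsr : s = w ++ r := by simpa using hz.symm
  subst hsr
  refine ⟨Γ ∪ Λ.image (fun t => t ++ w) ∪ {w}, u ++ w, ?_, ?_, by simp [g3], ?_⟩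
  · intro t ht
    simp only [Finset.mem_union, Finset.mem_image, Finset.mem_singleton] at ht
    by_cases ht0 : t = []
    · exact Or.inl ht0
    right
    rcases ht with (ht | ⟨t', ht', rfl⟩) | rfl
    · exact (g1 t ht).resolve_left ht0
    · have := hs.2 t' ht'
      rw [← List.append_assoc] at this
      exact lang_pre this ht0
    · exact lang_pre hs.1 ht0
  · obtain ⟨t, ht, ht'⟩ := g2
    exact ⟨t, by simp [ht], ht'⟩
  · ext z
    simp only [Set.mem_inter_iff, mem_uF]
    constructor
    · rintro ⟨⟨s', hs', rfl, a1, a2⟩, ⟨r', hr', b0, b1, b2⟩⟩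
      have hsr : s' = w ++ r' := by simpa using b0
      subst hsr
      refine ⟨r', hr', by simp, b1, ?_⟩
      intro t ht
      simp only [Finset.mem_union, Finset.mem_image, Finset.mem_singleton] at ht
      rcases ht with (ht | ⟨t', ht', rfl⟩) | rfl
      · exact b2 t ht
      · simpa using a2 t' ht'
      · exact a1
    · rintro ⟨r', hr', rfl, b1, b2⟩
      refine ⟨⟨w ++ r', by simp [hr'], by simp, b2 w (by simp), ?_⟩, ⟨r', hr', rfl, b1, ?_⟩⟩
      · intro t ht
        have := b2 (t ++ w) (by
          simp only [Finset.mem_union, Finset.mem_image]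
          exact Or.inl (Or.inr ⟨t, ht, rfl⟩))
        simpa using this
      · intro t ht
        exact b2 t (by simp [ht])

theorem constr_inter {X : Set (ℕ → α)} {A B : Set (List α)} (hA : Constructible X A)
    (hB : Constructible X B) : Constructible X (A ∩ B) := by
  classical
  by_cases hne : A ∩ B = ∅
  · left; exact hne
  obtain ⟨z, hzA, hzB⟩ := Set.nonempty_iff_ne_empty.2 hne
  rcases hA with rfl | ⟨Λ, u, h1, h2, h3, rfl⟩
  · simp at hzA
  rcases hB with rfl | ⟨Γ, v, g1, g2, g3, rfl⟩
  · simp at hzB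
  obtain ⟨s, hs, rfl⟩ := hzA
  obtain ⟨r, hr, hz⟩ := hzB
  have p1 : u <+: u ++ s := List.prefix_append _ _
  have p2 : v <+: u ++ s := ⟨r, hz⟩
  rcases List.prefix_or_prefix_of_prefix p1 p2 with ⟨w, rfl⟩ | ⟨w, rfl⟩
  · exact constr_inter_aux h1 h2 h3 g1 g2 g3
  · rw [Set.inter_comm]
    exact constr_inter_aux g1 g2 g3 h1 h2 h3

/-- A constructible set meeting all members of an ultrafilter belongs to it. -/
theorem ultra_mem {X : Set (ℕ → α)} {ξ : Set (Set (List α))} (hξ : IsCUltrafilter X ξ)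
    (hne : ξ.Nonempty) {B : Set (List α)} (hB : Constructible X B)
    (h : ∀ A ∈ ξ, (A ∩ B).Nonempty) : B ∈ ξ := by
  obtain ⟨⟨f1, f2, f3⟩, hmax⟩ := hξ
  have key := hmax {C | Constructible X C ∧ ∃ A ∈ ξ, A ∩ B ⊆ C} ⟨?_, ?_, ?_⟩ ?_
  · rw [← key]
    obtain ⟨A, hA⟩ := hne
    exact ⟨hB, A, hA, Set.inter_subset_right⟩
  · rintro C ⟨hC, A, hA, hAC⟩
    exact ⟨hC, ((h A hA).mono hAC).ne_empty⟩
  · rintro C ⟨hC, A, hA, hAC⟩ D ⟨hD, A', hA', hAD⟩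
    refine ⟨constr_inter hC hD, A ∩ A', f2 A hA A' hA', ?_⟩
    rintro x ⟨⟨x1, x2⟩, x3⟩
    exact ⟨hAC ⟨x1, x3⟩, hAD ⟨x2, x3⟩⟩
  · rintro C ⟨hC, A, hA, hAC⟩ D hD hCD
    exact ⟨hD, A, hA, hAC.trans hCD⟩
  · intro A hA
    exact ⟨(f1 A hA).1, A, hA, Set.inter_subset_left⟩

theorem filter_finite_inter {X : Set (ℕ → α)} {ξ : Set (Set (List α))} (hξ : IsCFilter X ξ)
    (hne : ξ.Nonempty) {ι : Type*} {T : Set ι} (hT : T.Finite) (f : ι → Set (List α))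
    (hf : ∀ i ∈ T, f i ∈ ξ) : ∃ A ∈ ξ, ∀ i ∈ T, A ⊆ f i := by
  induction T, hT using Set.Finite.induction_on with
  | empty => obtain ⟨A, hA⟩ := hne; exact ⟨A, hA, by simp⟩
  | @insert a S ha hS ih =>
    obtain ⟨A, hA, hA'⟩ := ih (fun i hi => hf i (Set.mem_insert_of_mem _ hi))
    refine ⟨A ∩ f a, hξ.2.1 A hA _ (hf a (Set.mem_insert _ _)), ?_⟩
    rintro i (rfl | hi)
    · exact Set.inter_subset_right
    · exact Set.inter_subset_left.trans (hA' i hi)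

/-- Ultrafilters meet finite covers. -/
theorem ultra_cover {X : Set (ℕ → α)} {ξ : Set (Set (List α))} (hξ : IsCUltrafilter X ξ)
    (hne : ξ.Nonempty) {T : Set (List α)} (hT : T.Finite)
    (h : ∀ A, Constructible X A → A.Nonempty → ∃ t ∈ T, (A ∩ Eset X t).Nonempty)
    (hTc : ∀ t ∈ T, t ≠ []) : ∃ t ∈ T, t ∈ language X ∧ Eset X t ∈ ξ := by
  by_contra! hcon
  have : ∀ t, ∃ A, t ∈ T → A ∈ ξ ∧ A ∩ Eset X t = ∅ := by
    intro t
    by_cases ht : t ∈ T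
    · by_cases htL : t ∈ language X
      · have h1 := hcon t ht htL
        by_contra! h2
        apply h1
        refine ultra_mem hξ hne (constr_Eset htL) ?_
        intro A hA
        have := (h2 A).2 hA
        exact this
      · obtain ⟨A, hA⟩ := hne
        refine ⟨A, fun _ => ⟨hA, ?_⟩⟩
        rw [Set.eq_empty_iff_forall_notMem]
        rintro w ⟨-, hw⟩
        obtain ⟨hw, s, hs, rfl⟩ := mem_Eset.1 hw
        exact htL (lang_pre hw (hTc t ht))
    · exact ⟨∅, fun h => absurd h ht⟩
  choose f hf using this
  obtain ⟨A, hA, hA'⟩ := filter_finite_inter hξ.1 hne hT f (fun t ht => (hf t ht).1)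
  obtain ⟨t, ht, w, hw1, hw2⟩ := h A (hξ.1.1 A hA).1
    (Set.nonempty_iff_ne_empty.2 (hξ.1.1 A hA).2)
  have : w ∈ f t ∩ Eset X t := ⟨hA' t ht hw1, hw2⟩
  rw [(hf t ht).2] at this
  exact this

theorem exists_ultra {X : Set (ℕ → α)} {A : Set (List α)} (hA : Constructible X A)
    (hne : A.Nonempty) : ∃ ξ, IsCUltrafilter X ξ ∧ A ∈ ξ := by
  have h0 : IsCFilter X {B | Constructible X B ∧ A ⊆ B} := by
    refine ⟨?_, ?_, ?_⟩
    · rintro B ⟨hB, hAB⟩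
      exact ⟨hB, (hne.mono hAB).ne_empty⟩
    · rintro B ⟨hB, hAB⟩ C ⟨hC, hAC⟩
      exact ⟨constr_inter hB hC, Set.subset_inter hAB hAC⟩
    · rintro B ⟨hB, hAB⟩ C hC hBC
      exact ⟨hC, hAB.trans hBC⟩
  obtain ⟨m, hm, hmax⟩ := zorn_subset_nonempty {ξ | IsCFilter X ξ} (by
    intro c hc hch hcne
    refine ⟨⋃₀ c, ⟨?_, ?_, ?_⟩, fun s hs => Set.subset_sUnion_of_mem hs⟩
    · rintro B ⟨ξ, hξ, hB⟩
      exact (hc hξ).1 B hB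
    · rintro B ⟨ξ, hξ, hB⟩ C ⟨η, hη, hC⟩
      rcases hch.total hξ hη with h | h
      · exact ⟨η, hη, (hc hη).2.1 B (h hB) C hC⟩
      · exact ⟨ξ, hξ, (hc hξ).2.1 B hB C (h hC)⟩
    · rintro B ⟨ξ, hξ, hB⟩ C hC hBC
      exact ⟨ξ, hξ, (hc hξ).2.2 B hB C hC hBC⟩) _ h0
  refine ⟨m, ⟨hmax.1, ?_⟩, hm ⟨hA, subset_rfl⟩⟩
  intro ξ' hξ' hsub
  exact Set.Subset.antisymm (hmax.2 hξ' hsub) hsub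

open Classical in
theorem ultra_char {X : Set (ℕ → α)} {ξ : Set (Set (List α))} (hξ : IsCUltrafilter X ξ)
    (hne : ξ.Nonempty) : IsUltraChar X (fun A => decide (A ∈ ξ)) := by
  obtain ⟨⟨f1, f2, f3⟩, hmax⟩ := hξ
  refine ⟨⟨?_, ?_, ?_⟩, ?_⟩
  · simp only [decide_eq_false_iff_not]
    intro h
    exact (f1 _ h).2 rfl
  · intro A B hA hB
    rw [← Bool.decide_and]
    apply decide_eq_decide.2
    constructor
    · intro h
      exact ⟨f3 _ h _ hA Set.inter_subset_left, f3 _ h _ hB Set.inter_subset_right⟩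
    · rintro ⟨a, b⟩
      exact f2 A a B b
  · obtain ⟨A, hA⟩ := hne
    exact ⟨A, (f1 A hA).1, by simpa using hA⟩
  · have : {A | Constructible X A ∧ decide (A ∈ ξ) = true} = ξ := by
      ext A
      simp only [decide_eq_true_eq, Set.mem_ofPred_eq]
      exact ⟨fun h => h.2, fun h => ⟨(f1 A h).1, h⟩⟩
    rw [this]
    exact ⟨⟨f1, f2, f3⟩, hmax⟩

/-- prefix of length n -/
def ipre (ω : ℕ → α) (n : ℕ) : List α := (List.range n).map ω

@[simp] theorem ipre_length (ω : ℕ → α) (n : ℕ) : (ipre ω n).length = n := by simp [ipre]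

theorem mem_infPrefixes {ω : ℕ → α} {w : List α} :
    w ∈ infPrefixes ω ↔ w ≠ [] ∧ w = ipre ω w.length := by
  unfold infPrefixes
  simp only [Set.mem_ofPred_eq]
  refine and_congr_right fun _ => ⟨fun h => ?_, fun h i => ?_⟩
  · apply List.ext_getElem (by simp)
    intro i h1 h2
    simpa [ipre] using h ⟨i, h1⟩
  · have : ∀ (l : List α) (hl : l = ipre ω w.length) (hi : (i : ℕ) < l.length), l[(i : ℕ)] = ω i := by
      intro l hl hi
      subst hl
      simp [ipre]
    exact this w h i.2

theorem infPrefixes_infinite (ω : ℕ → α) : (infPrefixes ω).Infinite := by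
  refine Set.infinite_of_injective_forall_mem (f := fun n : ℕ => ipre ω (n + 1)) ?_ ?_
  · intro a b h
    have := congrArg List.length h
    simpa using this
  · intro n
    refine mem_infPrefixes.2 ⟨?_, by simp⟩
    intro h
    have := congrArg List.length h
    simp at this

theorem shift_iter {X : Set (ℕ → α)} (hsh : ∀ x ∈ X, lshift x ∈ X) (k : ℕ) :
    ∀ x ∈ X, (fun n => x (k + n)) ∈ X := by
  induction k with
  | zero => intro x hx; simpa using hx
  | succ k ih =>
    intro x hx
    have := ih _ (hsh x hx)
    simpa [lshift, add_assoc, add_comm, add_left_comm] using this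

theorem mem_of_prefixes [TopologicalSpace α] [DiscreteTopology α]
    {X : Set (ℕ → α)} (hcl : IsClosed X) (hsh : ∀ x ∈ X, lshift x ∈ X) {ω : ℕ → α}
    (h : ∀ n, ipre ω (n + 1) ∈ language X) : ω ∈ X := by
  have : ∀ n, ∃ y ∈ X, ∀ i < n + 1, y i = ω i := by
    intro n
    obtain ⟨-, x, hx, k, hk⟩ := h n
    refine ⟨_, shift_iter hsh k x hx, fun i hi => ?_⟩
    have := hk ⟨i, by simpa using hi⟩
    simp [ipre] at this
    exact this.symm
  choose y hy hy' using this
  refine hcl.mem_of_tendsto (b := Filter.atTop) (f := y) ?_ (Filter.Eventually.of_forall hy)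
  rw [tendsto_pi_nhds]
  intro i
  refine tendsto_const_nhds.congr' ?_
  filter_upwards [Filter.eventually_ge_atTop i] with n hn
  exact (hy' n i (by omega)).symm

theorem finite_len [Finite α] (n : ℕ) : {w : List α | w.length = n}.Finite :=
  List.finite_length_eq α n

theorem infinite_long [Finite α] {A : Set (List α)} (hA : A.Infinite) (n : ℕ) :
    ∃ w ∈ A, n < w.length := by
  by_contra! h
  exact hA ((List.finite_length_le α n).subset h)

theorem ultra_eq [Finite α] [TopologicalSpace α] [DiscreteTopology α]
    {X : Set (ℕ → α)} (hcl : IsClosed X) (hsh : ∀ x ∈ X, lshift x ∈ X)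
    (h : ∀ A : Set (List α), Constructible X A → A.Nonempty → A.Infinite)
    {ξ : Set (Set (List α))} (hξ : IsCUltrafilter X ξ) (hne : ξ.Nonempty) :
    ∃ ω ∈ X, ξ = {A | Constructible X A ∧ (infPrefixes ω \ A).Finite} := by
  have hex : ∀ n, ∃ t : List α, t.length = n + 1 ∧ t ∈ language X ∧ Eset X t ∈ ξ := by
    intro n
    refine ultra_cover hξ hne (T := {w : List α | w.length = n + 1}) (finite_len (n + 1)) ?_ ?_
    · intro A hA hAne
      obtain ⟨w, hw, hl⟩ := infinite_long (h A hA hAne) (n + 1)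
      refine ⟨w.take (n + 1), (by rw [Set.mem_ofPred_eq, List.length_take]; omega), w, hw, mem_Eset.2 ⟨constr_sub hA hw,
        w.drop (n + 1), ?_, by simp⟩⟩
      simpa using hl
    · rintro t ht rfl
      rw [Set.mem_ofPred_eq] at ht
      simp at ht
  choose t ht htL htξ using hex
  have hpre : ∀ m n, m ≤ n → t m <+: t n := by
    intro m n hmn
    obtain ⟨w, hw1, hw2⟩ := Set.nonempty_iff_ne_empty.2
      (hξ.1.1 _ (hξ.1.2.1 _ (htξ m) _ (htξ n))).2
    obtain ⟨-, s, -, rfl⟩ := mem_Eset.1 hw1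
    obtain ⟨-, r, -, hr⟩ := mem_Eset.1 hw2
    exact List.prefix_of_prefix_length_le (List.prefix_append _ _) ⟨r, hr.symm⟩
      (by rw [ht, ht]; omega)
  let ω : ℕ → α := fun n => (t n)[n]'(by rw [ht]; omega)
  have htω : ∀ n, t n = ipre ω (n + 1) := by
    intro n
    apply List.ext_getElem (by simp [ht])
    intro i h1 h2
    have hi : i ≤ n := by rw [ht] at h1; omega
    have := (hpre i n hi).getElem (i := i) (by rw [ht]; omega)
    simp only [ipre, List.getElem_map, List.getElem_range]
    exact this.symm
  refine ⟨ω, mem_of_prefixes hcl hsh (fun n => htω n ▸ htL n), ?_⟩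
  symm
  apply hξ.2
  · refine ⟨?_, ?_, ?_⟩
    · rintro A ⟨hA, hf⟩
      refine ⟨hA, ?_⟩
      rintro rfl
      rw [Set.diff_empty] at hf
      exact infPrefixes_infinite ω hf
    · rintro A ⟨hA, hf⟩ B ⟨hB, hg⟩
      refine ⟨constr_inter hA hB, ?_⟩
      rw [Set.diff_inter]
      exact hf.union hg
    · rintro A ⟨hA, hf⟩ B hB hAB
      exact ⟨hB, hf.subset (Set.diff_subset_diff_right hAB)⟩
  · intro A hA
    refine ⟨(hξ.1.1 A hA).1, ?_⟩
    rcases (hξ.1.1 A hA).1 with rfl | ⟨Λ, u, h1, h2, h3, rfl⟩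
    · exact absurd rfl (hξ.1.1 _ hA).2
    refine (List.finite_length_le α u.length).subset ?_
    rintro w ⟨hw, hwA⟩
    by_contra hlen
    simp only [Set.mem_ofPred_eq, not_le] at hlen
    apply hwA
    obtain ⟨n, hn⟩ : ∃ n, w.length = n + 1 := ⟨w.length - 1, by omega⟩
    have hwt : w = t n := by
      rw [(mem_infPrefixes.1 hw).2, hn, htω]
    obtain ⟨z, hz1, hz2⟩ := Set.nonempty_iff_ne_empty.2
      (hξ.1.1 _ (hξ.1.2.1 _ hA _ (htξ n))).2
    obtain ⟨s, hs, rfl, a1, a2⟩ := mem_uF.1 hz1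
    obtain ⟨-, r, -, hr⟩ := mem_Eset.1 hz2
    rw [← hwt] at hr
    obtain ⟨s', rfl⟩ : u <+: w := List.prefix_of_prefix_length_le (List.prefix_append _ _)
      ⟨r, hr.symm⟩ hlen.le
    have hs' : s' ≠ [] := by
      rintro rfl
      simp at hlen
    have hsr : s = s' ++ r := by simpa using hr
    subst hsr
    refine mem_uF.2 ⟨s', hs', rfl, lang_pre a1 hs', fun t' ht' => ?_⟩
    have := a2 t' ht'
    rw [← List.append_assoc] at this
    exact lang_pre this (by simp [hs'])

theorem cover_imp {X : Set (ℕ → α)}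
    (h : ∀ A : Set (List α), Constructible X A → A.Nonempty →
          ∃ a : α, (A ∩ Eset X [a]).Nonempty) (Λ : Finset (List α))
    (h1 : ∀ t ∈ Λ, t = [] ∨ t ∈ language X)
    (h2 : ∃ t ∈ Λ, t ∈ language X) : FLam X Λ = ∅ ∨ (FLam X Λ).Infinite := by
  classical
  by_contra! hcon
  obtain ⟨hne, hfin⟩ := hcon
  obtain ⟨s, hs, hmax⟩ := hfin.exists_maximalFor List.length _ hne
  obtain ⟨s', b, rfl⟩ : ∃ s' b, s = s' ++ [b] :=
    ⟨s.dropLast, s.getLast hs.1.1, (List.dropLast_append_getLast hs.1.1).symm⟩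
  have key := h ((fun r => ([] : List α) ++ r) ''
    FLam X (Λ.image (fun t => t ++ s') ∪ {s'} ∪ {[]})) ?_ ?_
  · obtain ⟨a, w, hw1, hw2⟩ := key
    obtain ⟨r, hr, rfl, a1, a2⟩ := mem_uF.1 hw1
    obtain ⟨-, q, hq, hrq⟩ := mem_Eset.1 hw2
    subst hrq
    have hm : s' ++ ([a] ++ q) ∈ FLam X Λ := by
      refine ⟨a2 s' (by simp), fun t ht => ?_⟩
      have := a2 (t ++ s') (by
        simp only [Finset.mem_union, Finset.mem_image]
        exact Or.inl (Or.inl ⟨t, ht, rfl⟩))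
      rwa [List.append_assoc] at this
    have hle : s'.length + 1 ≤ (s' ++ ([a] ++ q)).length := by simp
    have := hmax hm (by simp; done)
    have hq' := List.length_pos_iff.2 hq
    have h3 : (s' ++ ([a] ++ q)).length ≤ (s' ++ [b]).length := this
    simp only [List.length_append, List.length_cons, List.length_nil] at h3
    omega
  · right
    refine ⟨_, [], ?_, ?_, by simp, rfl⟩
    · intro t ht
      by_cases ht0 : t = []
      · exact Or.inl ht0
      right
      simp only [Finset.mem_union, Finset.mem_image, Finset.mem_singleton] at ht
      rcases ht with (⟨t', ht', rfl⟩ | rfl) | rfl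
      · have := hs.2 t' ht'
        rw [← List.append_assoc] at this
        exact lang_pre this ht0
      · exact lang_pre hs.1 ht0
      · exact absurd rfl ht0
    · obtain ⟨t, ht, htL⟩ := h2
      refine ⟨t ++ s', ?_, ?_⟩
      · simp only [Finset.mem_union, Finset.mem_image]
        exact Or.inl (Or.inl ⟨t, ht, rfl⟩)
      · have := hs.2 t ht
        rw [← List.append_assoc] at this
        exact lang_pre this (by simp [htL.1])
  · refine ⟨[b], mem_uF.2 ⟨[b], by simp, by simp, lang_suf hs.1 (by simp), ?_⟩⟩
    intro t ht
    simp only [Finset.mem_union, Finset.mem_image, Finset.mem_singleton] at ht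
    rcases ht with (⟨t', ht', rfl⟩ | rfl) | rfl
    · simpa using hs.2 t' ht'
    · exact hs.1
    · exact lang_suf hs.1 (by simp)

/-- **Proposition (GroundForSubshifts).** For a subshift `X` over a finite alphabet the
following are equivalent:
(i) every set `F_Λ` (with `Λ` finite, each word empty or in `L_X`, at least one in `L_X`)
is empty or infinite;
(ii) every nonempty constructible set is infinite;
(iii) `{E_a : a ∈ Σ}` is a cover for `E(X)`: every nonempty constructible set meets
some `E_a`;
(iv) there is no ground ultra-character: every ultra-character `φ` satisfies
`φ(E_t) = 1` for some `t ∈ L_X`;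
(v) every ultra-character is of the form `φ_ω` for some `ω ∈ X`. -/
theorem stmt_8 {α : Type*} [Finite α] [TopologicalSpace α] [DiscreteTopology α]
    (X : Set (ℕ → α)) (hcl : IsClosed X) (hsh : ∀ x ∈ X, lshift x ∈ X) :
    List.TFAE
      [∀ Λ : Finset (List α), (∀ t ∈ Λ, t = [] ∨ t ∈ language X) →
          (∃ t ∈ Λ, t ∈ language X) → FLam X Λ = ∅ ∨ (FLam X Λ).Infinite,
       ∀ A : Set (List α), Constructible X A → A.Nonempty → A.Infinite,
       ∀ A : Set (List α), Constructible X A → A.Nonempty →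
          ∃ a : α, (A ∩ Eset X [a]).Nonempty,
       ∀ φ : Set (List α) → Bool, IsUltraChar X φ →
          ∃ t ∈ language X, φ (Eset X t) = true,
       ∀ φ : Set (List α) → Bool, IsUltraChar X φ →
          ∃ ω ∈ X, ∀ A : Set (List α), Constructible X A →
            (φ A = true ↔ (infPrefixes ω \ A).Finite)] := by
  tfae_have 1 → 2 := by
    rintro h A (rfl | ⟨Λ, u, h1, h2, h3, rfl⟩) hne
    · simp at hne
    · refine Set.Infinite.image (by simp [Set.InjOn]) ?_
      refine (h Λ h1 h2).resolve_left ?_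
      rw [Set.image_nonempty] at hne
      exact hne.ne_empty
  tfae_have 2 → 3 := by
    intro h A hA hne
    obtain ⟨w, hw, hl⟩ := infinite_long (h A hA hne) 1
    have hwL := constr_sub hA hw
    match w, hw, hl, hwL with
    | a :: s, hw, hl, hwL =>
      refine ⟨a, _, hw, mem_Eset.2 ⟨hwL, s, ?_, rfl⟩⟩
      rintro rfl
      simp at hl
  tfae_have 3 → 1 := fun h Λ h1 h2 => cover_imp h Λ h1 h2
  tfae_have 4 → 3 := by
    intro h A hA hne
    obtain ⟨ξ, hξ, hAξ⟩ := exists_ultra hA hne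
    obtain ⟨t, ht, ht2⟩ := h _ (ultra_char hξ ⟨A, hAξ⟩)
    have ht3 : Eset X t ∈ ξ := by simpa using ht2
    obtain ⟨w, hw1, hw2⟩ := Set.nonempty_iff_ne_empty.2
      (hξ.1.1 _ (hξ.1.2.1 _ hAξ _ ht3)).2
    obtain ⟨hwL, s, hs, rfl⟩ := mem_Eset.1 hw2
    match t, ht, hw1, hwL with
    | [], ht, _, _ => exact absurd rfl ht.1
    | a :: t', _, hw1, hwL =>
      exact ⟨a, _, hw1, mem_Eset.2 ⟨hwL, t' ++ s, by simp [hs], rfl⟩⟩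
  tfae_have 2 → 5 := by
    rintro h φ ⟨⟨-, -, A0, hA0, hA0'⟩, hφ⟩
    obtain ⟨ω, hω, heq⟩ := ultra_eq hcl hsh h hφ ⟨A0, hA0, hA0'⟩
    refine ⟨ω, hω, fun A hA => ?_⟩
    have := Set.ext_iff.1 heq A
    simpa [hA] using this
  tfae_have 5 → 4 := by
    intro h φ hφ
    obtain ⟨ω, hω, hA⟩ := h φ hφ
    have hL : ∀ w ∈ infPrefixes ω, w ∈ language X := by
      rintro w ⟨hw, hw'⟩
      exact ⟨hw, ω, hω, 0, by simpa using hw'⟩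
    have hmem : ∀ w ∈ infPrefixes ω, ∃ s, w = ω 0 :: s := by
      rintro w ⟨hw, hw'⟩
      match w, hw, hw' with
      | a :: s, _, hw' =>
        have := hw' ⟨0, by simp⟩
        simp at this
        exact ⟨s, by rw [this]⟩
    have h0 : [ω 0] ∈ language X := hL _ ⟨by simp, by simp⟩
    refine ⟨[ω 0], h0, (hA _ (constr_Eset h0)).2 ?_⟩
    refine (Set.finite_singleton [ω 0]).subset ?_
    rintro w ⟨hw, hwE⟩
    obtain ⟨s, rfl⟩ := hmem w hw
    by_cases hs : s = []
    · subst hs; rfl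
    · exact absurd (mem_Eset.2 ⟨hL _ hw, s, hs, rfl⟩) hwE
  tfae_finish
end

section
/- Let X be a subshift on a finite alphabet Σ. For every ω ∈ X, the map φ_ω is a character on the semilattice E(X) of constructible sets, and φ_ω is essentially tight. In particular, the set Ê_max := {φ_ω : ω ∈ X} is contained in the set Ê_ess of essentially tight characters on E(X). -/
open Set

variable {α : Type*}

open scoped Classical in
/-- `φ_ω`: the `{0,1}`-valued map sending a set `A` to `1` iff `σ_ω ∖ A` is finite. -/
noncomputable def phiOm (ω : ℕ → α) : Set (List α) → Bool :=
  fun A => if (infPrefixes ω \ A).Finite then true else false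

theorem lang_prefix (X : Set (ℕ → α)) {v w : List α} (hv : v ∈ language X) (hw : w ≠ [])
    (h : w <+: v) : w ∈ language X := by
  obtain ⟨_, x, hx, k, hk⟩ := hv
  refine ⟨hw, x, hx, k, fun i => ?_⟩
  have h1 := hk ⟨i, lt_of_lt_of_le i.2 h.length_le⟩
  rw [← h1]
  simpa using h.getElem i.2

theorem infPrefixes_prefix {ω : ℕ → α} {v w : List α} (hv : v ∈ infPrefixes ω)
    (hw : w ∈ infPrefixes ω) (h : w.length ≤ v.length) : w <+: v := by
  rw [List.prefix_iff_eq_take]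
  apply List.ext_getElem
  · simp [h]
  · intro n h1 h2
    have a := hw.2 ⟨n, h1⟩
    have b := hv.2 ⟨n, lt_of_lt_of_le h1 h⟩
    simp only [List.get_eq_getElem] at a b
    simp [a, b]

theorem exists_long [Finite α] {S : Set (List α)} (h : S.Infinite) (n : ℕ) :
    ∃ v ∈ S, n < v.length := by
  by_contra! hc
  exact h ((List.finite_length_le α n).subset hc)

theorem key_dichotomy [Finite α] (X : Set (ℕ → α)) (ω : ℕ → α) {B : Set (List α)}
    (hB : Constructible X B) (h : (infPrefixes ω ∩ B).Infinite) :
    (infPrefixes ω \ B).Finite := by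
  rcases hB with rfl | ⟨Λ, u, -, -, -, rfl⟩
  · simp at h
  refine (List.finite_length_le α u.length).subset ?_
  rintro w ⟨hw, hwB⟩
  by_contra hlen
  simp only [mem_setOf_eq, not_le] at hlen
  apply hwB
  obtain ⟨v, ⟨hv, s, hs, rfl⟩, hl⟩ := exists_long h w.length
  have hp := infPrefixes_prefix hv hw hl.le
  have hu : u <+: w := List.prefix_of_prefix_length_le (List.prefix_append u s) hp hlen.le
  obtain ⟨r, rfl⟩ := hu
  have hr : r ≠ [] := by
    rintro rfl
    simp at hlen
  have hrs : r <+: s := by simpa using hp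
  refine ⟨r, ⟨lang_prefix X hs.1 hr hrs, fun t ht => ?_⟩, rfl⟩
  exact lang_prefix X (hs.2 t ht) (by simp [hr]) (by simpa using hrs)

theorem phiOm_true (ω : ℕ → α) (A : Set (List α)) :
    phiOm ω A = true ↔ (infPrefixes ω \ A).Finite := by
  simp [phiOm]

theorem inter_inf (ω : ℕ → α) {A : Set (List α)} (h : (infPrefixes ω \ A).Finite) :
    (infPrefixes ω ∩ A).Infinite := by
  intro h2
  apply infPrefixes_infinite ω
  rw [← Set.inter_union_sdiff (infPrefixes ω) A]
  exact h2.union h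

theorem phi_char [Finite α] (X : Set (ℕ → α)) (ω : ℕ → α) (hω : ω ∈ X) :
    IsCharacter X (phiOm ω) := by
  classical
  refine ⟨?_, ?_, ?_⟩
  · rw [Bool.eq_false_iff, Ne, phiOm_true, Set.sdiff_empty]
    exact infPrefixes_infinite ω
  · intro A B _ _
    rw [Bool.eq_iff_iff, Bool.and_eq_true, phiOm_true, phiOm_true, phiOm_true, Set.sdiff_inter,
      Set.finite_union]
  · have hu : [ω 0] ∈ language X := ⟨by simp, ω, hω, 0, by simp⟩
    refine ⟨(fun s => [ω 0] ++ s) '' FLam X {[ω 0]}, Or.inr ⟨{[ω 0]}, [ω 0], ?_, ?_, ?_, rfl⟩, ?_⟩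
    · intro t ht
      rw [Finset.mem_singleton] at ht
      exact Or.inr (ht ▸ hu)
    · exact ⟨_, Finset.mem_singleton_self _, hu⟩
    · simp
    rw [phiOm_true]
    refine (List.finite_length_le α 1).subset ?_
    rintro w ⟨hw, hwB⟩
    by_contra hlen
    simp only [mem_setOf_eq, not_le] at hlen
    apply hwB
    obtain ⟨hne, hg⟩ := hw
    match w, hlen, hne, hg with
    | a :: r, hlen, hne, hg =>
      have h0 : a = ω 0 := by simpa using hg ⟨0, by simp⟩
      subst h0
      refine ⟨r, ⟨⟨?_, ω, hω, 1, fun i => ?_⟩, ?_⟩, rfl⟩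
      · rintro rfl
        simp at hlen
      · have := hg ⟨i + 1, by simp⟩
        simp only [List.get_eq_getElem, List.getElem_cons_succ] at this
        simpa [add_comm] using this
      · intro t ht
        rw [Finset.mem_singleton] at ht
        subst ht
        refine ⟨by simp, ω, hω, 0, fun i => ?_⟩
        simpa using hg i

theorem phi_tight [Finite α] (X : Set (ℕ → α)) (ω : ℕ → α) :
    IsEssTightChar X (phiOm ω) := by
  intro A n B hA hB hfin
  simp only [phiOm_true]
  have h1 : (A \ ⋃ i, B i).Finite := hfin.subset (fun x hx => Or.inl hx)
  have h2 : ((⋃ i, B i) \ A).Finite := hfin.subset (fun x hx => Or.inr hx)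
  constructor
  · intro h
    by_contra! hc
    have hf : ∀ i, (infPrefixes ω ∩ B i).Finite := fun i => by
      by_contra hi
      exact hc i (key_dichotomy X ω (hB i) hi)
    apply inter_inf ω h
    refine ((Set.finite_iUnion hf).union h1).subset ?_
    rintro x ⟨hx, hxA⟩
    by_cases hxB : x ∈ ⋃ i, B i
    · obtain ⟨i, hi⟩ := mem_iUnion.1 hxB
      exact Or.inl (mem_iUnion.2 ⟨i, hx, hi⟩)
    · exact Or.inr ⟨hxA, hxB⟩
  · rintro ⟨i, hi⟩
    apply key_dichotomy X ω hA
    intro hf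
    apply inter_inf ω hi
    refine (hf.union h2).subset ?_
    rintro x ⟨hx, hxB⟩
    by_cases hxA : x ∈ A
    · exact Or.inl ⟨hx, hxA⟩
    · exact Or.inr ⟨mem_iUnion.2 ⟨i, hxB⟩, hxA⟩

/-- **(Section: Subsets of the spectrum / UnboundedIsEssential for subshifts).**
Let `X` be a subshift on a finite alphabet.  For every `ω ∈ X`, the map `φ_ω` is a
character on the semilattice `E(X)` of constructible sets, and `φ_ω` is essentially
tight.  In particular `Ê_max = {φ_ω : ω ∈ X}` is contained in the set `Ê_ess` of
essentially tight characters. -/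
theorem stmt_13 {α : Type*} [Finite α] [TopologicalSpace α] [DiscreteTopology α]
    (X : Set (ℕ → α)) (hcl : IsClosed X) (hsh : ∀ x ∈ X, lshift x ∈ X) :
    (∀ ω ∈ X, IsCharacter X (phiOm ω) ∧ IsEssTightChar X (phiOm ω)) ∧
    {φ : Set (List α) → Bool | ∃ ω ∈ X, φ = phiOm ω} ⊆
      {φ : Set (List α) → Bool | IsCharacter X φ ∧ IsEssTightChar X φ} := by
  have key : ∀ ω ∈ X, IsCharacter X (phiOm ω) ∧ IsEssTightChar X (phiOm ω) :=
    fun ω hω => ⟨phi_char X ω hω, phi_tight X ω⟩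
  refine ⟨key, ?_⟩
  rintro _ ⟨ω, hω, rfl⟩
  exact key ω hω
end

section
/- For the five-letter subshift X below, there exists a character on E(X) which is essentially tight but not tight. -/
open Set

variable {α : Type*}

/-- The forbidden words: `1·0ⁿ·4·x` with `x ∈ {0,2,3,4}`, `2·0ⁿ·4·y` with
`y ∈ {0,1,3,4}`, and `3·0ⁿ·4`, for `n ≥ 1`. -/
def Forb : Set (List (Fin 5)) :=
  {w | ∃ n : ℕ, 1 ≤ n ∧
    ((∃ x : Fin 5, x ∈ ({0, 2, 3, 4} : Set (Fin 5)) ∧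
        w = 1 :: (List.replicate n 0 ++ [4, x])) ∨
     (∃ y : Fin 5, y ∈ ({0, 1, 3, 4} : Set (Fin 5)) ∧
        w = 2 :: (List.replicate n 0 ++ [4, y])) ∨
     w = 3 :: (List.replicate n 0 ++ [4]))}

/-- The subshift on `Σ = {0,1,2,3,4}` of all infinite words having no factor in `Forb`. -/
def X5 : Set (ℕ → Fin 5) := {ω | ∀ w ∈ Forb, ¬ OccursIn w ω}

/-- A tight character on `E(X)`: for all finite families `𝒳, 𝒴` of constructible sets
and every finite cover `Z` for `E(X)^{𝒳,𝒴}`, if `φ = 1` on `𝒳` and `φ = 0` on `𝒴`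
then `φ = 1` on some member of `Z`. -/
def IsTightChar (X : Set (ℕ → Fin 5)) (φ : Set (List (Fin 5)) → Bool) : Prop :=
  ∀ XX YY Z : Finset (Set (List (Fin 5))),
    (∀ A ∈ XX, Constructible X A) → (∀ B ∈ YY, Constructible X B) →
    (∀ C ∈ Z, Constructible X C ∧ (∀ A ∈ XX, C ⊆ A) ∧ (∀ B ∈ YY, C ∩ B = ∅)) →
    (∀ D : Set (List (Fin 5)), Constructible X D → (∀ A ∈ XX, D ⊆ A) →
      (∀ B ∈ YY, D ∩ B = ∅) → D.Nonempty → ∃ C ∈ Z, (D ∩ C).Nonempty) →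
    (∀ A ∈ XX, φ A = true) → (∀ B ∈ YY, φ B = false) →
    ∃ C ∈ Z, φ C = true

def Good5 (x : ℕ → Fin 5) : Prop :=
  ∀ p n : ℕ, 1 ≤ n → (∀ i, 1 ≤ i → i ≤ n → x (p + i) = 0) → x (p + n + 1) = 4 →
    x p ≠ 3 ∧ (x p = 1 → x (p + n + 2) = 1) ∧ (x p = 2 → x (p + n + 2) = 2)

theorem occ_iff {w : List (Fin 5)} {x : ℕ → Fin 5} :
    OccursIn w x ↔ ∃ k, ∀ i, i < w.length → w[i]? = some (x (k + i)) := by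
  unfold OccursIn
  constructor
  · rintro ⟨k, h⟩
    refine ⟨k, fun i hi => ?_⟩
    have := h ⟨i, hi⟩
    simp only [List.get_eq_getElem] at this
    rw [List.getElem?_eq_getElem hi, this]
  · rintro ⟨k, h⟩
    refine ⟨k, fun i => ?_⟩
    have := h i i.2
    rw [List.getElem?_eq_getElem i.2] at this
    simpa using this

theorem occ_pat1 {a b : Fin 5} {n : ℕ} {x : ℕ → Fin 5} {p : ℕ}
    (h0 : x p = a) (hz : ∀ i, 1 ≤ i → i ≤ n → x (p + i) = 0) (h4 : x (p + n + 1) = 4)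
    (hb : x (p + n + 2) = b) : OccursIn (a :: (List.replicate n 0 ++ [4, b])) x := by
  rw [occ_iff]
  refine ⟨p, fun i hi => ?_⟩
  simp at hi
  rcases i with _ | i
  · simp [h0]
  · rw [List.getElem?_cons_succ]
    by_cases h : i < n
    · rw [List.getElem?_append_left (by simpa using h)]
      rw [hz (i+1) (by omega) (by omega)]
      simp [h]
    · rw [List.getElem?_append_right (by simpa using h)]
      obtain rfl | rfl : i = n ∨ i = n + 1 := by omega
      · simp [← h4, add_assoc]
      · simp [← hb, add_assoc]

theorem occ_pat2 {a : Fin 5} {n : ℕ} {x : ℕ → Fin 5} {p : ℕ}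
    (h0 : x p = a) (hz : ∀ i, 1 ≤ i → i ≤ n → x (p + i) = 0) (h4 : x (p + n + 1) = 4) :
    OccursIn (a :: (List.replicate n 0 ++ [4])) x := by
  rw [occ_iff]
  refine ⟨p, fun i hi => ?_⟩
  simp at hi
  rcases i with _ | i
  · simp [h0]
  · rw [List.getElem?_cons_succ]
    by_cases h : i < n
    · rw [List.getElem?_append_left (by simpa using h)]
      rw [hz (i+1) (by omega) (by omega)]
      simp [h]
    · rw [List.getElem?_append_right (by simpa using h)]
      obtain rfl : i = n := by omega
      simp [← h4, add_assoc]

theorem pat_occ {a : Fin 5} {l : List (Fin 5)} {n : ℕ} {x : ℕ → Fin 5}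
    (h : OccursIn (a :: (List.replicate n 0 ++ 4 :: l)) x) :
    ∃ p, x p = a ∧ (∀ i, 1 ≤ i → i ≤ n → x (p + i) = 0) ∧ x (p + n + 1) = 4 ∧
      ∀ b, l = [b] → x (p + n + 2) = b := by
  rw [occ_iff] at h
  obtain ⟨p, h⟩ := h
  refine ⟨p, ?_, ?_, ?_, ?_⟩
  · have := h 0 (by simp)
    simpa using this.symm
  · intro i h1 h2
    obtain ⟨j, rfl⟩ : ∃ j, i = j + 1 := ⟨i - 1, by omega⟩
    have := h (j+1) (by simp; omega)
    rw [List.getElem?_cons_succ, List.getElem?_append_left (by simp; omega)] at this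
    simpa [show j < n by omega] using this.symm
  · have := h (n+1) (by simp)
    rw [List.getElem?_cons_succ, List.getElem?_append_right (by simp)] at this
    simpa [add_assoc] using this.symm
  · rintro b rfl
    have := h (n+2) (by simp)
    rw [List.getElem?_cons_succ, List.getElem?_append_right (by simp)] at this
    simpa [add_assoc] using this.symm

theorem mem_X5 {x : ℕ → Fin 5} : x ∈ X5 ↔ Good5 x := by
  constructor
  · intro h p n hn hz h4
    refine ⟨fun h3 => ?_, fun h1 => ?_, fun h2 => ?_⟩
    · exact h _ ⟨n, hn, Or.inr (Or.inr rfl)⟩ (occ_pat2 h3 hz h4)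
    · by_contra hc
      refine h _ ⟨n, hn, Or.inl ⟨x (p+n+2), ?_, rfl⟩⟩ (occ_pat1 h1 hz h4 rfl)
      generalize x (p+n+2) = y at hc
      revert y; simp; decide
    · by_contra hc
      refine h _ ⟨n, hn, Or.inr (Or.inl ⟨x (p+n+2), ?_, rfl⟩)⟩ (occ_pat1 h2 hz h4 rfl)
      generalize x (p+n+2) = y at hc
      revert y; simp; decide
  · rintro h w ⟨n, hn, ⟨b, hb, rfl⟩ | ⟨b, hb, rfl⟩ | rfl⟩ ho
    · obtain ⟨p, h0, hz, h4, hl⟩ := pat_occ ho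
      have := (h p n hn hz h4).2.1 h0
      rw [hl b rfl] at this
      subst this; simp at hb
    · obtain ⟨p, h0, hz, h4, hl⟩ := pat_occ ho
      have := (h p n hn hz h4).2.2 h0
      rw [hl b rfl] at this
      subst this; simp at hb
    · obtain ⟨p, h0, hz, h4, hl⟩ := pat_occ ho
      exact (h p n hn hz h4).1 h0

theorem good_shift {x : ℕ → Fin 5} (h : Good5 x) (k : ℕ) : Good5 (fun i => x (k + i)) := by
  intro p n hn hz h4
  have := h (k + p) n hn (fun i h1 h2 => by rw [add_assoc]; exact hz i h1 h2)
    (by simpa [add_assoc] using h4)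
  simpa [add_assoc] using this

theorem mem_lang {w : List (Fin 5)} : w ∈ language X5 ↔
    w ≠ [] ∧ ∃ x, Good5 x ∧ ∀ i, i < w.length → w[i]? = some (x i) := by
  constructor
  · rintro ⟨h, x, hx, ho⟩
    obtain ⟨k, ho⟩ := occ_iff.1 ho
    exact ⟨h, _, good_shift (mem_X5.1 hx) k, ho⟩
  · rintro ⟨h, x, hx, ho⟩
    exact ⟨h, x, mem_X5.2 hx, occ_iff.2 ⟨0, by simpa using ho⟩⟩

theorem lang_tail {a : Fin 5} {w : List (Fin 5)} (h : a :: w ∈ language X5) (hw : w ≠ []) :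
    w ∈ language X5 := by
  obtain ⟨_, x, hx, ho⟩ := mem_lang.1 h
  refine mem_lang.2 ⟨hw, _, good_shift hx 1, fun i hi => ?_⟩
  have := ho (i+1) (by simpa using hi)
  rw [List.getElem?_cons_succ] at this
  rw [this, add_comm]

theorem lang_swap {v : List (Fin 5)} (h : v ++ [4] ∈ language X5) : v ++ [0] ∈ language X5 := by
  obtain ⟨_, x, hx, ho⟩ := mem_lang.1 h
  have hv : x v.length = 4 := by
    have := ho v.length (by simp)
    simpa using this.symm
  refine mem_lang.2 ⟨by simp, fun i => if i < v.length then x i else 0, ?_, ?_⟩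
  · intro p n hn hz h4
    have h5 : p + n + 1 < v.length := by
      by_contra hc
      simp [hc] at h4
    have key := hx p n hn (fun i h1 h2 => by
      have := hz i h1 h2
      simpa [show p + i < v.length by omega] using this) (by simpa [h5] using h4)
    have hp : p < v.length := by omega
    by_cases h6 : p + n + 2 < v.length
    · simpa [hp, h6] using key
    · have : p + n + 2 = v.length := by omega
      rw [this, hv] at key
      simp only [hp, if_true, this, lt_irrefl, if_false]
      refine ⟨key.1, fun h => ?_, fun h => ?_⟩
      · exact absurd (key.2.1 h) (by decide)
      · exact absurd (key.2.2 h) (by decide)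
  · intro i hi
    simp at hi
    by_cases h : i < v.length
    · have := ho i (by simp; omega)
      rw [List.getElem?_append_left h] at this ⊢
      rw [this]; simp [h]
    · obtain rfl : i = v.length := by omega
      simp

theorem lang_zeros (a : Fin 5) (n : ℕ) : a :: List.replicate n 0 ∈ language X5 := by
  refine mem_lang.2 ⟨by simp, fun i => if i = 0 then a else 0, ?_, ?_⟩
  · intro p n hn hz h4
    simp at h4
  · intro i hi
    rcases i with _ | i
    · simp
    · simp at hi
      simp [hi]

theorem lang_four (a : Fin 5) (ha : a = 1 ∨ a = 2) (n : ℕ) :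
    a :: (List.replicate n 0 ++ [4]) ∈ language X5 := by
  refine mem_lang.2 ⟨by simp,
    fun i => if i = 0 then a else if i ≤ n then 0 else if i = n + 1 then 4 else a, ?_, ?_⟩
  · intro p m hm hz h4
    have ha0 : a ≠ 0 := by rcases ha with rfl | rfl <;> decide
    have ha3 : a ≠ 3 := by rcases ha with rfl | rfl <;> decide
    have ha4 : a ≠ 4 := by rcases ha with rfl | rfl <;> decide
    have hpm : p + m = n := by
      by_contra hc
      by_cases h : p + m + 1 ≤ n
      · simp [h] at h4
      · simp [h, hc, ha4] at h4
    have h2 : (if p + m + 2 = 0 then a else if p + m + 2 ≤ n then 0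
      else if p + m + 2 = n + 1 then 4 else a) = a := by
      rw [if_neg (by omega), if_neg (by omega), if_neg (by omega)]
    simp only [h2]
    by_cases hp : p = 0
    · simp [hp, ha3]
    · have : p ≤ n := by omega
      simp [hp, this]
  · intro i hi
    simp at hi
    rcases i with _ | i
    · simp
    · rw [List.getElem?_cons_succ]
      by_cases h : i < n
      · rw [List.getElem?_append_left (by simpa using h)]
        simp [h]
      · obtain rfl : i = n := by omega
        rw [List.getElem?_append_right (by simp)]
        simp

theorem lang_three (n : ℕ) (hn : 1 ≤ n) : 3 :: (List.replicate n 0 ++ [4]) ∉ language X5 := by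
  rintro ⟨_, x, hx, ho⟩
  exact hx _ ⟨n, hn, Or.inr (Or.inr rfl)⟩ ho

theorem lang_char {w : List (Fin 5)} (h1 : 1 :: w ∈ language X5)
    (h2 : 2 :: w ∈ language X5) (h3 : 3 :: w ∉ language X5) :
    ∃ n, w = List.replicate n 0 ++ [4] := by
  obtain ⟨_, x, hx, ho⟩ := mem_lang.1 h1
  have hw : ∀ i, i < w.length → w[i]? = some (x (i + 1)) := fun i hi => by
    have := ho (i+1) (by simpa using hi)
    rwa [List.getElem?_cons_succ] at this
  have hx0 : x 0 = 1 := by simpa using (ho 0 (by simp)).symm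
  have hng : ¬ Good5 (fun i => if i = 0 then 3 else x i) := by
    intro hg
    apply h3
    refine mem_lang.2 ⟨by simp, _, hg, fun i hi => ?_⟩
    rcases i with _ | i
    · simp
    · rw [List.getElem?_cons_succ, hw i (by simpa using hi)]
      simp
  have hex : ∃ n, 1 ≤ n ∧ (∀ i, 1 ≤ i → i ≤ n → x i = 0) ∧ x (n + 1) = 4 := by
    by_contra hc
    apply hng
    intro p n hn hz h4
    have hz' : ∀ i, 1 ≤ i → i ≤ n → x (p + i) = 0 := fun i a b => by
      have := hz i a b
      simpa [show ¬ (p = 0 ∧ i = 0) by omega, show p + i ≠ 0 by omega] using this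
    have h4' : x (p + n + 1) = 4 := by simpa using h4
    by_cases hp : p = 0
    · subst hp
      exact absurd ⟨n, hn, by simpa using hz', by simpa using h4'⟩ hc
    · have := hx p n hn hz' h4'
      simpa [hp] using this
  obtain ⟨n, hn, hz, h4⟩ := hex
  have h11 := (hx 0 n hn (by simpa using hz) (by simpa using h4)).2.1 hx0
  simp only [zero_add] at h11
  rcases lt_trichotomy w.length (n + 1) with h | h | h
  · exfalso
    apply h3
    have : w = List.replicate w.length 0 := by
      apply List.ext_getElem?
      intro i
      by_cases hi : i < w.length
      · rw [hw i hi, hz (i+1) (by omega) (by omega)]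
        simp [hi]
      · simp [hi]
    rw [this]
    exact lang_zeros 3 _
  · refine ⟨n, ?_⟩
    apply List.ext_getElem?
    intro i
    by_cases hi : i < w.length
    · rw [hw i hi]
      by_cases h' : i < n
      · rw [List.getElem?_append_left (by simpa using h'), hz (i+1) (by omega) (by omega)]
        simp [h']
      · obtain rfl : i = n := by omega
        rw [List.getElem?_append_right (by simp), h4]
        simp
    · rw [List.getElem?_eq_none (by omega), List.getElem?_eq_none (by simp; omega)]
  · exfalso
    obtain ⟨_, y, hy, hoy⟩ := mem_lang.1 h2
    have hxy : ∀ i, i < w.length → y (i + 1) = x (i + 1) := fun i hi => by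
      have := hoy (i+1) (by simpa using hi)
      rw [List.getElem?_cons_succ, hw i hi] at this
      simpa using this.symm
    have hy0 : y 0 = 2 := by simpa using (hoy 0 (by simp)).symm
    have := (hy 0 n hn (fun i a b => by
      obtain ⟨j, rfl⟩ : ∃ j, i = j + 1 := ⟨i - 1, by omega⟩
      rw [zero_add, hxy j (by omega), hz _ a b]) (by
      rw [zero_add, hxy n (by omega), h4])).2.2 hy0
    rw [zero_add, hxy (n+1) h, h11] at this
    exact absurd this (by decide)

theorem constr_F (Λ : Finset (List (Fin 5))) (h0 : [] ∈ Λ) (h1 : [1] ∈ Λ)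
    (h : ∀ t ∈ Λ, t = [] ∨ t ∈ language X5) : Constructible X5 (FLam X5 Λ) :=
  Or.inr ⟨Λ, [], h, ⟨[1], h1, lang_zeros 1 0⟩, h0, by simp⟩

/-- **Proposition.** For the five-letter subshift `X5` there exists a character on
`E(X)` which is essentially tight but not tight. -/
theorem stmt_16 :
    ∃ φ : Set (List (Fin 5)) → Bool,
      IsCharacter X5 φ ∧ IsEssTightChar X5 φ ∧ ¬ IsTightChar X5 φ := by
  classical
  let U : Ultrafilter ℕ := Filter.hyperfilter ℕ
  have hU : ∀ k : ℕ, ∀ᶠ n in (U : Filter ℕ), k ≤ n := fun k =>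
    Nat.hyperfilter_le_atTop (Filter.eventually_ge_atTop k)
  let w : ℕ → List (Fin 5) := fun n => List.replicate n 0 ++ [4]
  have winj : Function.Injective w := fun a b h => by
    have := congrArg List.length h
    simpa [w] using this
  let φ : Set (List (Fin 5)) → Bool := fun A => decide (∀ᶠ n in (U : Filter ℕ), w n ∈ A)
  have hφ : ∀ A, φ A = true ↔ ∀ᶠ n in (U : Filter ℕ), w n ∈ A := fun A => by simp [φ]
  let Λ2 : Finset (List (Fin 5)) := {[], [1], [2]}
  let Λ3 : Finset (List (Fin 5)) := {[], [1], [2], [3]}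
  have c2 : Constructible X5 (FLam X5 Λ2) := constr_F _ (by simp [Λ2]) (by simp [Λ2]) (by
    intro t ht
    simp only [Λ2, Finset.mem_insert, Finset.mem_singleton] at ht
    rcases ht with rfl | rfl | rfl
    · exact Or.inl rfl
    · exact Or.inr (lang_zeros 1 0)
    · exact Or.inr (lang_zeros 2 0))
  have c3 : Constructible X5 (FLam X5 Λ3) := constr_F _ (by simp [Λ3]) (by simp [Λ3]) (by
    intro t ht
    simp only [Λ3, Finset.mem_insert, Finset.mem_singleton] at ht
    rcases ht with rfl | rfl | rfl | rfl
    · exact Or.inl rfl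
    · exact Or.inr (lang_zeros 1 0)
    · exact Or.inr (lang_zeros 2 0)
    · exact Or.inr (lang_zeros 3 0))
  have m2 : ∀ s, s ∈ FLam X5 Λ2 ↔
      s ∈ language X5 ∧ 1 :: s ∈ language X5 ∧ 2 :: s ∈ language X5 := fun s => by
    simp [FLam, Λ2]
    tauto
  have m3 : ∀ s, s ∈ FLam X5 Λ3 ↔ s ∈ language X5 ∧ 1 :: s ∈ language X5 ∧
      2 :: s ∈ language X5 ∧ 3 :: s ∈ language X5 := fun s => by
    simp [FLam, Λ3]
    tauto
  have p2 : φ (FLam X5 Λ2) = true := by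
    rw [hφ]
    refine Filter.Eventually.of_forall fun n => ?_
    rw [m2]
    exact ⟨lang_tail (lang_four 1 (Or.inl rfl) n) (by simp [w]),
      lang_four 1 (Or.inl rfl) n, lang_four 2 (Or.inr rfl) n⟩
  have p3 : φ (FLam X5 Λ3) = false := by
    rw [← Bool.not_eq_true, hφ]
    intro h
    obtain ⟨n, h, hn⟩ := (h.and (hU 1)).exists
    exact lang_three n hn ((m3 _).1 h).2.2.2
  refine ⟨φ, ⟨?_, ?_, _, c2, p2⟩, ?_, ?_⟩
  · rw [← Bool.not_eq_true, hφ]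
    intro h
    obtain ⟨n, h⟩ := h.exists
    exact h
  · intro A B _ _
    rw [Bool.eq_iff_iff, Bool.and_eq_true, hφ, hφ, hφ, ← Filter.eventually_and]
    rfl
  · intro A n B _ _ hfin
    have hne : ∀ᶠ k in (U : Filter ℕ), w k ∉ symmDiff A (⋃ i, B i) := by
      have hf : (w ⁻¹' symmDiff A (⋃ i, B i)).Finite := hfin.preimage winj.injOn
      obtain ⟨b, hb⟩ := hf.bddAbove
      filter_upwards [hU (b+1)] with k hk hmem
      have := hb hmem
      omega
    have hiff : ∀ᶠ k in (U : Filter ℕ), (w k ∈ A ↔ ∃ i, w k ∈ B i) := by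
      filter_upwards [hne] with k hk
      simp only [Set.mem_symmDiff, Set.mem_iUnion] at hk
      tauto
    rw [hφ, Filter.eventually_congr hiff]
    simp only [hφ]
    exact Ultrafilter.eventually_exists_iff
  · intro ht
    obtain ⟨C, hC, _⟩ := ht {FLam X5 Λ2} {FLam X5 Λ3} ∅ (by simpa using c2) (by simpa using c3)
      (by simp) (by
        intro D hD hX hY hne
        exfalso
        simp only [Finset.mem_singleton, forall_eq] at hX hY
        rcases hD with rfl | ⟨Λ, u, -, -, hu, rfl⟩
        · exact Set.not_nonempty_empty hne
        obtain ⟨_, s, hs, rfl⟩ := hne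
        have key : ∀ s ∈ FLam X5 Λ, u ++ s ∈ FLam X5 Λ2 ∧ u ++ s ∉ FLam X5 Λ3 := by
          intro s hs
          refine ⟨hX ⟨s, hs, rfl⟩, fun h => ?_⟩
          have : u ++ s ∈ (∅ : Set (List (Fin 5))) := hY ▸ ⟨⟨s, hs, rfl⟩, h⟩
          exact this
        obtain ⟨k2, k3⟩ := key s hs
        rw [m2] at k2
        rw [m3] at k3
        obtain ⟨n, hn⟩ := lang_char k2.2.1 k2.2.2 (fun h => k3 ⟨k2.1, k2.2.1, k2.2.2, h⟩)
        rcases List.eq_nil_or_concat s with rfl | ⟨s', b, rfl⟩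
        · exact hs.1.1 rfl
        rw [List.concat_eq_append] at hs hn
        rw [← List.append_assoc] at hn
        obtain ⟨e1, e2⟩ := List.append_inj' hn rfl
        obtain rfl : b = 4 := by simpa using e2
        have hs0 : s' ++ [0] ∈ FLam X5 Λ := by
          refine ⟨lang_swap hs.1, fun t ht => ?_⟩
          rw [← List.append_assoc]
          apply lang_swap
          rw [List.append_assoc]
          exact hs.2 t ht
        apply (key _ hs0).2
        rw [m3, ← List.append_assoc, e1, ← List.replicate_succ']
        exact ⟨lang_tail (lang_zeros 1 _) (by simp), lang_zeros 1 _, lang_zeros 2 _,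
          lang_zeros 3 _⟩)
      (by simpa using p2) (by simpa using p3)
    simp at hC
end
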